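/- arXiv:1802.07529 — 3 statements merged into one kernel-verified Lean document; each statement's English description precedes it below -/
import Mathlib

section
/- Let K₁ and K₂ be nonempty closed convex subsets of a real Hilbert space H, with metric projections P₁ onto K₁ and P₂ onto K₂, and let Q := P₁ ∘ P₂. Suppose that either (a) K₁ or K₂ is compact, or (b) one of K₁, K₂ is contained in a finite-dimensional affine subspace of H and the distance between the sets is attained, i.e. there exist a ∈ K₁, b ∈ K₂ with ‖a − b‖ = dist(K₁, K₂). Then for every x ∈ H the sequence (Qⁿ(x))ₙ converges in norm to a fixed point of Q. -/
open Filter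

/-- `P` is the metric (nearest-point) projection onto the set `C`. -/
def IsProjOn {H : Type*} [NormedAddCommGroup H] (P : H → H) (C : Set H) : Prop :=
  ∀ x : H, P x ∈ C ∧ ∀ y ∈ C, ‖x - P x‖ ≤ ‖x - y‖

/-- The distance between two sets: `inf {‖a − b‖ : a ∈ A, b ∈ B}`. -/
noncomputable def setDist {H : Type*} [NormedAddCommGroup H] (A B : Set H) : ℝ :=
  sInf {d : ℝ | ∃ a ∈ A, ∃ b ∈ B, d = ‖a - b‖}

open Topology

section Helpers
variable {H : Type*} [NormedAddCommGroup H] [InnerProductSpace ℝ H]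

theorem proj_var {C : Set H} (hC : Convex ℝ C) {P : H → H} (hP : IsProjOn P C) (x : H) :
    ∀ y ∈ C, inner ℝ (x - P x) (y - P x) ≤ 0 := by
  rw [← norm_eq_iInf_iff_real_inner_le_zero hC (hP x).1]
  have : Nonempty C := ⟨⟨P x, (hP x).1⟩⟩
  refine le_antisymm (le_ciInf fun w => (hP x).2 w w.2) ?_
  exact ciInf_le (f := fun w : C => ‖x - w‖)
    ⟨0, by rintro _ ⟨w, rfl⟩; exact norm_nonneg _⟩ ⟨P x, (hP x).1⟩

theorem proj_pyth {C : Set H} (hC : Convex ℝ C) {P : H → H} (hP : IsProjOn P C) (x : H)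
    {y : H} (hy : y ∈ C) : ‖x - P x‖ ^ 2 + ‖y - P x‖ ^ 2 ≤ ‖x - y‖ ^ 2 := by
  have h := proj_var hC hP x y hy
  have e : x - y = (x - P x) - (y - P x) := by abel
  rw [e, norm_sub_sq_real (x - P x) (y - P x)]
  linarith

theorem proj_nonexp {C : Set H} (hC : Convex ℝ C) {P : H → H} (hP : IsProjOn P C) (x y : H) :
    ‖P x - P y‖ ≤ ‖x - y‖ := by
  have h1 := proj_var hC hP x (P y) (hP y).1
  have h2 := proj_var hC hP y (P x) (hP x).1
  have h3 : ‖P x - P y‖ ^ 2 ≤ inner ℝ (x - y) (P x - P y) := by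
    rw [← real_inner_self_eq_norm_sq]
    have e1 : inner ℝ (x - P x) (P y - P x) = - inner ℝ (x - P x) (P x - P y) := by
      rw [← inner_neg_right, neg_sub]
    have e2 : x - y = (x - P x) - (y - P y) + (P x - P y) := by abel
    rw [e2, inner_add_left, inner_sub_left (x - P x) (y - P y)]
    linarith
  have h4 := real_inner_le_norm (x - y) (P x - P y)
  by_contra hlt
  push Not at hlt
  nlinarith [norm_nonneg (x - y), norm_nonneg (P x - P y)]

theorem proj_unique {C : Set H} (hC : Convex ℝ C) {P : H → H} (hP : IsProjOn P C) {x y : H}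
    (hy : y ∈ C) (h : ‖x - y‖ ≤ ‖x - P x‖) : P x = y := by
  have h1 := proj_pyth hC hP x hy
  have h2 : ‖x - y‖ ^ 2 ≤ ‖x - P x‖ ^ 2 := by gcongr
  have h3 : ‖y - P x‖ = 0 := by nlinarith [norm_nonneg (y - P x)]
  exact (sub_eq_zero.1 (norm_eq_zero.1 h3)).symm

theorem compact_inter {C : Set H} (hC : IsClosed C) (V : AffineSubspace ℝ H)
    (hV : FiniteDimensional ℝ V.direction) (hCV : C ⊆ (V : Set H)) {p : H} (hp : p ∈ C) (R : ℝ) :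
    IsCompact (C ∩ Metric.closedBall p R) := by
  have hK : IsCompact ((fun v : V.direction => (v : H) + p) '' Metric.closedBall 0 R) :=
    (isCompact_closedBall (0 : V.direction) R).image (by fun_prop)
  refine hK.of_isClosed_subset (hC.inter Metric.isClosed_closedBall) ?_
  rintro y ⟨hy, hyR⟩
  refine ⟨⟨y - p, V.vsub_mem_direction (hCV hy) (hCV hp)⟩, ?_, by simp⟩
  simpa [dist_eq_norm] using hyR

theorem asymp_reg {K₁ K₂ : Set H} (hcv₁ : Convex ℝ K₁)
    {P₁ P₂ : H → H} (hP₁ : IsProjOn P₁ K₁) (hP₂ : IsProjOn P₂ K₂)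
    (u : ℕ → H) (hu : ∀ n, u (n + 1) = P₁ (P₂ (u n))) (hu0 : ∀ n, u n ∈ K₁) :
    Tendsto (fun n => u (n + 1) - u n) atTop (𝓝 0) := by
  set d : ℕ → ℝ := fun n => ‖u n - P₂ (u n)‖ ^ 2 with hd
  have key : ∀ n, ‖u (n + 1) - u n‖ ^ 2 ≤ d n - d (n + 1) := by
    intro n
    have h1 := proj_pyth hcv₁ hP₁ (P₂ (u n)) (hu0 n)
    have h2 := (hP₂ (u (n + 1))).2 _ (hP₂ (u n)).1
    rw [← hu, norm_sub_rev (P₂ (u n)) (u (n + 1)), norm_sub_rev (P₂ (u n)) (u n),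
      norm_sub_rev (u n) (u (n + 1))] at h1
    have h3 : ‖u (n + 1) - P₂ (u (n + 1))‖ ^ 2 ≤ ‖u (n + 1) - P₂ (u n)‖ ^ 2 := by gcongr
    simp only [hd]
    linarith
  have hanti : Antitone d := antitone_nat_of_succ_le fun n => by
    nlinarith [key n, sq_nonneg ‖u (n + 1) - u n‖]
  have hlim := tendsto_atTop_ciInf hanti ⟨0, by rintro _ ⟨n, rfl⟩; positivity⟩
  have h0 : Tendsto (fun n => d n - d (n + 1)) atTop (𝓝 0) := by
    simpa using hlim.sub (hlim.comp (tendsto_add_atTop_nat 1))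
  have hsq : Tendsto (fun n => ‖u (n + 1) - u n‖ ^ 2) atTop (𝓝 0) :=
    squeeze_zero (fun n => by positivity) key h0
  rw [tendsto_zero_iff_norm_tendsto_zero]
  simpa using hsq.sqrt

theorem conv_of_cluster {Q : H → H} (hQ : ∀ x y, ‖Q x - Q y‖ ≤ ‖x - y‖)
    (u : ℕ → H) (hu : ∀ n, u (n + 1) = Q (u n))
    (hreg : Tendsto (fun n => u (n + 1) - u n) atTop (𝓝 0))
    {z : H} {φ : ℕ → ℕ} (hφ : Tendsto φ atTop atTop) (hz : Tendsto (fun n => u (φ n)) atTop (𝓝 z)) :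
    Q z = z ∧ Tendsto u atTop (𝓝 z) := by
  have hc : Continuous Q := by
    refine (LipschitzWith.of_dist_le_mul (K := 1) fun x y => ?_).continuous
    simpa [dist_eq_norm] using hQ x y
  have hfix : Q z = z := by
    have h1 : Tendsto (fun n => Q (u (φ n)) - u (φ n)) atTop (𝓝 (Q z - z)) :=
      ((hc.tendsto z).comp hz).sub hz
    have h2 : Tendsto (fun n => Q (u (φ n)) - u (φ n)) atTop (𝓝 0) := by
      simpa [Function.comp_def, hu] using hreg.comp hφ
    exact sub_eq_zero.1 (tendsto_nhds_unique h1 h2)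
  refine ⟨hfix, ?_⟩
  have hanti : Antitone fun n => ‖u n - z‖ := antitone_nat_of_succ_le fun n => by
    have := hQ (u n) z
    rwa [hfix, ← hu] at this
  have hlim := tendsto_atTop_ciInf hanti ⟨0, by rintro _ ⟨n, rfl⟩; positivity⟩
  have h0 : Tendsto (fun n => ‖u (φ n) - z‖) atTop (𝓝 0) :=
    tendsto_iff_norm_sub_tendsto_zero.1 hz
  rw [tendsto_nhds_unique (hlim.comp hφ) h0] at hlim
  exact tendsto_iff_norm_sub_tendsto_zero.2 hlim

end Helpers

/-- Cheney–Goldstein: convergence of iterates of `Q = P₁ ∘ P₂` to a fixed point of `Q`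
when (a) one of the sets is compact, or (b) one of the sets lies in a finite-dimensional
affine subspace and the distance between the sets is attained. -/
theorem stmt1 {H : Type*} [NormedAddCommGroup H] [InnerProductSpace ℝ H] [CompleteSpace H]
    (K₁ K₂ : Set H) (hne₁ : K₁.Nonempty) (hne₂ : K₂.Nonempty)
    (hcl₁ : IsClosed K₁) (hcl₂ : IsClosed K₂)
    (hcv₁ : Convex ℝ K₁) (hcv₂ : Convex ℝ K₂)
    (P₁ P₂ : H → H) (hP₁ : IsProjOn P₁ K₁) (hP₂ : IsProjOn P₂ K₂)
    (hcase : (IsCompact K₁ ∨ IsCompact K₂) ∨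
      ((∃ V : AffineSubspace ℝ H, FiniteDimensional ℝ V.direction ∧
          (K₁ ⊆ (V : Set H) ∨ K₂ ⊆ (V : Set H))) ∧
        ∃ a ∈ K₁, ∃ b ∈ K₂, ‖a - b‖ = setDist K₁ K₂)) :
    ∀ x : H, ∃ z : H, (P₁ ∘ P₂) z = z ∧
      Tendsto (fun n : ℕ => (P₁ ∘ P₂)^[n] x) atTop (nhds z) := by
  intro x
  have hQ : ∀ x y, ‖(P₁ ∘ P₂) x - (P₁ ∘ P₂) y‖ ≤ ‖x - y‖ := fun x y =>
    (proj_nonexp hcv₁ hP₁ _ _).trans (proj_nonexp hcv₂ hP₂ _ _)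
  set u : ℕ → H := fun n => (P₁ ∘ P₂)^[n + 1] x with hudef
  have hu : ∀ n, u (n + 1) = (P₁ ∘ P₂) (u n) := fun n => by
    simp only [hudef]; rw [Function.iterate_succ_apply']
  have hu1 : ∀ n, u n ∈ K₁ := fun n => by
    simp only [hudef]; rw [Function.iterate_succ_apply']; exact (hP₁ _).1
  have hreg := asymp_reg hcv₁ hP₁ hP₂ u hu hu1
  suffices hcl : ∃ z, ∃ φ : ℕ → ℕ, Tendsto φ atTop atTop ∧
      Tendsto (fun n => u (φ n)) atTop (nhds z) by
    obtain ⟨z, φ, hφ, hz⟩ := hcl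
    obtain ⟨h1, h2⟩ := conv_of_cluster hQ u hu hreg hφ hz
    exact ⟨z, h1, (tendsto_add_atTop_iff_nat 1).1 h2⟩
  have hS : (∃ S, IsCompact S ∧ ∀ n, u n ∈ S) ∨ (∃ S, IsCompact S ∧ ∀ n, P₂ (u n) ∈ S) := by
    rcases hcase with (h | h) | ⟨⟨V, hV, hKV⟩, a, ha, b, hb, hab⟩
    · exact Or.inl ⟨K₁, h, hu1⟩
    · exact Or.inr ⟨K₂, h, fun n => (hP₂ _).1⟩
    · have hmin : ∀ a' ∈ K₁, ∀ b' ∈ K₂, ‖a - b‖ ≤ ‖a' - b'‖ := by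
        intro a' ha' b' hb'
        rw [hab]
        exact csInf_le ⟨0, by rintro _ ⟨_, _, _, _, rfl⟩; exact norm_nonneg _⟩
          ⟨a', ha', b', hb', rfl⟩
      have hb2 : P₂ a = b := proj_unique hcv₂ hP₂ hb (hmin _ ha _ (hP₂ a).1)
      have ha1 : P₁ b = a := proj_unique hcv₁ hP₁ ha (by
        rw [norm_sub_rev b a, norm_sub_rev b (P₁ b)]; exact hmin _ (hP₁ b).1 _ hb)
      have hbd : ∀ n, ‖u n - a‖ ≤ ‖u 0 - a‖ := by
        intro n
        induction n with
        | zero => exact le_rfl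
        | succ n ih =>
          have := hQ (u n) a
          rw [← hu, Function.comp_apply, hb2, ha1] at this
          exact this.trans ih
      rcases hKV with h | h
      · refine Or.inl ⟨_, compact_inter hcl₁ V hV h ha ‖u 0 - a‖, fun n => ⟨hu1 n, ?_⟩⟩
        rw [Metric.mem_closedBall, dist_eq_norm]
        exact hbd n
      · refine Or.inr ⟨_, compact_inter hcl₂ V hV h hb ‖u 0 - a‖, fun n => ⟨(hP₂ _).1, ?_⟩⟩
        rw [Metric.mem_closedBall, dist_eq_norm, ← hb2]
        exact (proj_nonexp hcv₂ hP₂ _ _).trans (hbd n)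
  rcases hS with ⟨S, hS, hmem⟩ | ⟨S, hS, hmem⟩
  · obtain ⟨z, -, φ, hφ, hz⟩ := hS.tendsto_subseq hmem
    exact ⟨z, φ, hφ.tendsto_atTop, hz⟩
  · obtain ⟨w, -, φ, hφ, hw⟩ := hS.tendsto_subseq hmem
    refine ⟨P₁ w, fun n => φ n + 1, (tendsto_add_atTop_nat 1).comp hφ.tendsto_atTop, ?_⟩
    have hc : Continuous P₁ := by
      refine (LipschitzWith.of_dist_le_mul (K := 1) fun x y => ?_).continuous
      simpa [dist_eq_norm] using proj_nonexp hcv₁ hP₁ x y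
    simp only [hu]
    exact (hc.tendsto w).comp hw
end

section
/- Let C₁, C₂, …, C_m be nonempty closed convex subsets of a real Hilbert space H and suppose C₁ is bounded. Let x⁰ ∈ H be arbitrary and define the cyclic projection sequence x^{n+1} = P_{i(n)}(xⁿ) where i(n) = (n mod m) + 1, so that x^{km+i} ∈ C_i for all k ≥ 0 and i = 1, …, m. Then there exist points x̄₁ ∈ C₁, …, x̄_m ∈ C_m forming a cycle, i.e. P_{i+1}(x̄_i) = x̄_{i+1} for i = 1, …, m−1 and P₁(x̄_m) = x̄₁, such that for each i: the differences x^{km+i+1} − x^{km+i} converge in norm to x̄_{i+1} − x̄_i as k → ∞, and the subsequence (x^{km+i})_k converges weakly to x̄_i. -/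
open Filter

local notation "⟪" x ", " y "⟫" => @inner ℝ _ _ x y

section CyclicHelpers

variable {H : Type*} [NormedAddCommGroup H] [InnerProductSpace ℝ H]

/-- Firm nonexpansiveness. -/
def FirmNE (f : H → H) : Prop :=
  ∀ x y, ‖f x - f y‖ ^ 2 + ‖(x - f x) - (y - f y)‖ ^ 2 ≤ ‖x - y‖ ^ 2

lemma proj_firm {P : H → H} {C : Set H} (hC : Convex ℝ C) (hP : IsProjOn P C) : FirmNE P := by
  have var : ∀ x, ∀ w ∈ C, ⟪x - P x, w - P x⟫ ≤ 0 := by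
    intro x
    have h := (norm_eq_iInf_iff_real_inner_le_zero hC (u := x) (hP x).1).1 ?_
    · exact h
    · haveI : Nonempty C := ⟨⟨P x, (hP x).1⟩⟩
      apply le_antisymm
      · exact le_ciInf fun w => (hP x).2 w w.2
      · exact ciInf_le (f := fun w : C => ‖x - w‖)
          ⟨0, by rintro _ ⟨w, rfl⟩; exact norm_nonneg _⟩ ⟨P x, (hP x).1⟩
  intro x y
  have h1 := var x (P y) (hP y).1
  have h2 := var y (P x) (hP x).1
  have e : x - y = (P x - P y) + ((x - P x) - (y - P y)) := by abel
  rw [e, norm_add_sq_real]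
  have : ⟪P x - P y, (x - P x) - (y - P y)⟫ = -⟪x - P x, P y - P x⟫ - ⟪y - P y, P x - P y⟫ := by
    rw [inner_sub_right, real_inner_comm (x - P x), real_inner_comm (y - P y),
      ← neg_sub (P x) (P y), inner_neg_right]
    ring
  linarith

lemma FirmNE.ne {f : H → H} (hf : FirmNE f) (x y : H) : ‖f x - f y‖ ≤ ‖x - y‖ := by
  have := hf x y
  refine le_of_sq_le_sq ?_ (norm_nonneg _)
  nlinarith [sq_nonneg ‖(x - f x) - (y - f y)‖]

lemma weak_ultra [CompleteSpace H] (u : ℕ → H) (R : ℝ) (hR : ∀ k, ‖u k‖ ≤ R) (U : Ultrafilter ℕ) :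
    ∃ c : H, ∀ y, Tendsto (fun k => ⟪u k, y⟫) U (nhds ⟪c, y⟫) := by
  have key : ∀ y, ∃ l : ℝ, |l| ≤ R * ‖y‖ ∧ Tendsto (fun k => ⟪u k, y⟫) U (nhds l) := by
    intro y
    have hc : IsCompact (Set.Icc (-(R * ‖y‖)) (R * ‖y‖)) := isCompact_Icc
    obtain ⟨l, hl, hle⟩ := hc.ultrafilter_le_nhds (U.map (fun k => ⟪u k, y⟫)) (by
      rw [le_principal_iff, Ultrafilter.mem_coe, Ultrafilter.mem_map]
      refine Filter.mem_of_superset Filter.univ_mem ?_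
      intro k _
      have h := abs_real_inner_le_norm (u k) y
      have h2 : ‖u k‖ * ‖y‖ ≤ R * ‖y‖ := mul_le_mul_of_nonneg_right (hR k) (norm_nonneg _)
      exact abs_le.1 (h.trans h2))
    exact ⟨l, abs_le.2 hl, hle⟩
  choose f hf1 hf2 using key
  let F : H →ₗ[ℝ] ℝ :=
    { toFun := f
      map_add' := fun a b => by
        refine tendsto_nhds_unique (hf2 (a + b)) ?_
        simpa only [inner_add_right] using (hf2 a).add (hf2 b)
      map_smul' := fun r a => by
        refine tendsto_nhds_unique (hf2 (r • a)) ?_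
        simpa only [inner_smul_right, RingHom.id_apply, smul_eq_mul] using (hf2 a).const_mul r }
  let G : H →L[ℝ] ℝ := F.mkContinuous R (fun y => hf1 y)
  refine ⟨(InnerProductSpace.toDual ℝ H).symm G, fun y => ?_⟩
  rw [InnerProductSpace.toDual_symm_apply]
  exact hf2 y

lemma demiclosed [CompleteSpace H] (T : H → H) (hT : ∀ x y, ‖T x - T y‖ ≤ ‖x - y‖)
    (u : ℕ → H) (R : ℝ) (hR : ∀ k, ‖u k‖ ≤ R)
    (hu : Tendsto (fun k => u k - T (u k)) atTop (nhds 0))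
    (U : Ultrafilter ℕ) (hU : (U : Filter ℕ) ≤ atTop) :
    ∃ c : H, T c = c ∧ ∀ y, Tendsto (fun k => ⟪u k, y⟫) U (nhds ⟪c, y⟫) := by
  obtain ⟨c, hc⟩ := weak_ultra u R hR U
  refine ⟨c, ?_, hc⟩
  have hn : Tendsto (fun k => ‖u k - T (u k)‖) U (nhds 0) := by
    simpa using (hu.mono_left hU).norm
  have l1 : Tendsto (fun k => ‖c - T c‖ ^ 2 + 2 * (⟪u k, c - T c⟫ - ⟪c, c - T c⟫)) U
      (nhds (‖c - T c‖ ^ 2 + 2 * (⟪c, c - T c⟫ - ⟪c, c - T c⟫))) :=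
    tendsto_const_nhds.add (((hc (c - T c)).sub tendsto_const_nhds).const_mul 2)
  have l2 : Tendsto (fun k => ‖u k - T (u k)‖ ^ 2 + 2 * (‖u k - T (u k)‖ * (R + ‖c‖))) U
      (nhds (0 ^ 2 + 2 * (0 * (R + ‖c‖)))) :=
    (hn.pow 2).add ((hn.mul_const _).const_mul 2)
  have hle := le_of_tendsto_of_tendsto' l1 l2 (fun k => by
    have e : u k - T c = (u k - c) + (c - T c) := by abel
    have h1 := norm_add_sq_real (u k - c) (c - T c)
    rw [← e] at h1
    have h2 : ‖u k - T c‖ ≤ ‖u k - T (u k)‖ + ‖u k - c‖ := by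
      calc ‖u k - T c‖ = ‖(u k - T (u k)) + (T (u k) - T c)‖ := by congr 1; abel
        _ ≤ _ := (norm_add_le _ _).trans (by gcongr; exact hT _ _)
    have h3 : ‖u k - c‖ ≤ R + ‖c‖ := (norm_sub_le _ _).trans (by gcongr; exact hR k)
    have h4 : ‖u k - T c‖ ^ 2 ≤ (‖u k - T (u k)‖ + ‖u k - c‖) ^ 2 := by gcongr
    have h5 := mul_le_mul_of_nonneg_left h3 (norm_nonneg (u k - T (u k)))
    rw [← inner_sub_left]
    nlinarith)
  have : ‖c - T c‖ ^ 2 ≤ 0 := by simpa using hle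
  have : ‖c - T c‖ = 0 := by nlinarith [norm_nonneg (c - T c)]
  exact (sub_eq_zero.1 (norm_eq_zero.1 this)).symm

lemma exists_fixed [CompleteSpace H] (T : H → H) (hT : ∀ x y, ‖T x - T y‖ ≤ ‖x - y‖)
    (R : ℝ) (hR : ∀ x, ‖T x‖ ≤ R) : ∃ c, T c = c := by
  have key : ∀ n : ℕ, ∃ v : H, v = (1 - 1 / ((n : ℝ) + 1)) • T v := by
    intro n
    have hpos : 0 < 1 / ((n : ℝ) + 1) := by positivity
    have hle : 1 / ((n : ℝ) + 1) ≤ 1 := by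
      rw [div_le_one (by positivity)]; linarith [(Nat.cast_nonneg n : (0:ℝ) ≤ n)]
    have hcon : ContractingWith ⟨1 - 1 / ((n : ℝ) + 1), by linarith⟩
        (fun v : H => (1 - 1 / ((n : ℝ) + 1)) • T v) := by
      constructor
      · apply NNReal.coe_lt_coe.1
        change 1 - 1 / ((n : ℝ) + 1) < 1
        linarith
      · refine LipschitzWith.of_dist_le_mul fun a b => ?_
        rw [dist_eq_norm, dist_eq_norm, ← smul_sub, norm_smul, Real.norm_of_nonneg (by linarith)]
        exact mul_le_mul_of_nonneg_left (hT a b) (by linarith)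
    exact ⟨hcon.fixedPoint, hcon.fixedPoint_isFixedPt.symm⟩
  choose v hv using key
  have hd : ∀ n, ‖v n - T (v n)‖ ≤ 1 / ((n : ℝ) + 1) * R := by
    intro n
    have : v n - T (v n) = -((1 / ((n : ℝ) + 1)) • T (v n)) := by
      nth_rewrite 1 [hv n]
      rw [sub_smul, one_smul]; abel
    rw [this, norm_neg, norm_smul, Real.norm_of_nonneg (by positivity)]
    exact mul_le_mul_of_nonneg_left (hR _) (by positivity)
  have hlim : Tendsto (fun n => v n - T (v n)) atTop (nhds 0) := by
    refine squeeze_zero_norm hd ?_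
    simpa using (tendsto_one_div_add_atTop_nhds_zero_nat (𝕜 := ℝ)).mul_const R
  have hb : ∀ n, ‖v n‖ ≤ R := by
    intro n
    have hpos : 0 < 1 / ((n : ℝ) + 1) := by positivity
    have hle : 1 / ((n : ℝ) + 1) ≤ 1 := by
      rw [div_le_one (by positivity)]; linarith [(Nat.cast_nonneg n : (0:ℝ) ≤ n)]
    rw [hv n, norm_smul, Real.norm_of_nonneg (by linarith)]
    have := hR (v n)
    nlinarith [norm_nonneg (T (v n))]
  obtain ⟨c, hc, -⟩ := demiclosed T hT v R hb hlim (Ultrafilter.of atTop) (Ultrafilter.of_le _)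
  exact ⟨c, hc⟩

lemma weak_conv [CompleteSpace H] (T : H → H) (hT : ∀ x y, ‖T x - T y‖ ≤ ‖x - y‖)
    (u : ℕ → H) (R : ℝ) (hR : ∀ k, ‖u k‖ ≤ R) (huT : ∀ k, u (k + 1) = T (u k))
    (hu : Tendsto (fun k => u k - u (k + 1)) atTop (nhds 0)) :
    ∃ c : H, T c = c ∧ ∀ y, Tendsto (fun k => ⟪u k, y⟫) atTop (nhds ⟪c, y⟫) := by
  simp only [huT] at hu
  have dem := demiclosed T hT u R hR hu
  obtain ⟨c, hc, hcl⟩ := dem (Ultrafilter.of atTop) (Ultrafilter.of_le _)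
  have conv : ∀ p, T p = p → ∃ l, Tendsto (fun k => ‖u k - p‖ ^ 2) atTop (nhds l) := by
    intro p hp
    have hanti : Antitone (fun k => ‖u k - p‖ ^ 2) := by
      refine antitone_nat_of_succ_le fun k => ?_
      have : ‖u (k + 1) - p‖ ≤ ‖u k - p‖ := by
        rw [huT]; nth_rewrite 1 [← hp]; exact hT _ _
      gcongr
    exact ⟨_, tendsto_atTop_ciInf hanti ⟨0, by rintro _ ⟨w, rfl⟩; positivity⟩⟩
  refine ⟨c, hc, fun y => ?_⟩
  rw [tendsto_iff_ultrafilter]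
  intro V hV
  obtain ⟨d, hd, hdl⟩ := dem V hV
  suffices d = c by subst this; exact hdl y
  obtain ⟨a, ha⟩ := conv c hc
  obtain ⟨b, hb⟩ := conv d hd
  have hlim : Tendsto (fun k => ⟪u k, c - d⟫) atTop
      (nhds ((b - a + ‖c‖ ^ 2 - ‖d‖ ^ 2) / 2)) := by
    refine Tendsto.congr (fun k => ?_)
      ((((hb.sub ha).add_const (‖c‖ ^ 2)).sub_const (‖d‖ ^ 2)).div_const 2)
    rw [norm_sub_sq_real, norm_sub_sq_real, inner_sub_right]
    ring
  have e1 := tendsto_nhds_unique (hcl (c - d)) (hlim.mono_left (Ultrafilter.of_le _))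
  have e2 := tendsto_nhds_unique (hdl (c - d)) (hlim.mono_left hV)
  have : ⟪c - d, c - d⟫ = 0 := by rw [inner_sub_left, e1, e2, sub_self]
  exact (sub_eq_zero.1 (inner_self_eq_zero.1 this)).symm

/-- Orbit of the cyclic maps. -/
def orb (Q : ℕ → H → H) (p : H) : ℕ → H
  | 0 => p
  | n + 1 => Q (n + 1) (orb Q p n)

lemma orb_unique (Q : ℕ → H → H) (w : ℕ → H) (hw : ∀ n, w (n + 1) = Q (n + 1) (w n)) (n : ℕ) :
    w n = orb Q (w 0) n := by
  induction n with
  | zero => rfl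
  | succ n ih => rw [hw, ih]; rfl

lemma orb_ne (Q : ℕ → H → H) (hQ : ∀ n, FirmNE (Q n)) (p q : H) (n : ℕ) :
    ‖orb Q p n - orb Q q n‖ ≤ ‖p - q‖ := by
  induction n with
  | zero => exact le_rfl
  | succ n ih => exact ((hQ (n + 1)).ne _ _).trans ih

lemma diff_tendsto (Q : ℕ → H → H) (hQ : ∀ n, FirmNE (Q n)) (w z : ℕ → H)
    (hw : ∀ n, w (n + 1) = Q (n + 1) (w n)) (hz : ∀ n, z (n + 1) = Q (n + 1) (z n)) (j : ℕ) :
    Tendsto (fun n => (w (n + j) - z (n + j)) - (w n - z n)) atTop (nhds 0) := by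
  have step : ∀ n, ‖w (n + 1) - z (n + 1)‖ ^ 2 +
      ‖(w (n + 1) - z (n + 1)) - (w n - z n)‖ ^ 2 ≤ ‖w n - z n‖ ^ 2 := by
    intro n
    have h := hQ (n + 1) (w n) (z n)
    rw [← hw, ← hz] at h
    have e : (w n - w (n + 1)) - (z n - z (n + 1)) =
        -((w (n + 1) - z (n + 1)) - (w n - z n)) := by abel
    rwa [e, norm_neg] at h
  have hanti : Antitone (fun k => ‖w k - z k‖ ^ 2) :=
    antitone_nat_of_succ_le fun k => by
      have := step k
      nlinarith [sq_nonneg ‖(w (k + 1) - z (k + 1)) - (w k - z k)‖]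
  have hl := tendsto_atTop_ciInf hanti ⟨0, by rintro _ ⟨w, rfl⟩; positivity⟩
  have one : Tendsto (fun n => (w (n + 1) - z (n + 1)) - (w n - z n)) atTop (nhds 0) := by
    rw [tendsto_zero_iff_norm_tendsto_zero]
    have hsq : Tendsto (fun n => ‖(w (n + 1) - z (n + 1)) - (w n - z n)‖ ^ 2) atTop (nhds 0) := by
      refine squeeze_zero (fun n => by positivity) (fun n => ?_)
        (g := fun n => ‖w n - z n‖ ^ 2 - ‖w (n + 1) - z (n + 1)‖ ^ 2) ?_
      · have := step n; linarith
      · simpa using hl.sub (hl.comp (tendsto_add_atTop_nat 1))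
    have := hsq.sqrt
    simpa using this
  induction j with
  | zero => simp
  | succ j ih =>
    have h2 := (one.comp (tendsto_add_atTop_nat j)).add ih
    rw [add_zero] at h2
    refine h2.congr fun n => ?_
    simp only [Function.comp, add_assoc]
    abel

lemma cyclic_main [CompleteSpace H] (m : ℕ) (hm : 0 < m) (Q : ℕ → H → H) (hQ : ∀ n, FirmNE (Q n))
    (hper : ∀ n, Q (n + m) = Q n) (R : ℝ) (hR : ∀ p, ‖Q m p‖ ≤ R)
    (w : ℕ → H) (hw : ∀ n, w (n + 1) = Q (n + 1) (w n)) (hw0 : ‖w 0‖ ≤ R) :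
    ∃ z : ℕ → H, (∀ n, z (n + 1) = Q (n + 1) (z n)) ∧ (∀ n, z (n + m) = z n) ∧
      (∀ j, Tendsto (fun n => (w (n + j) - z (n + j)) - (w n - z n)) atTop (nhds 0)) ∧
      ∀ y, Tendsto (fun k => ⟪w (k * m), y⟫) atTop (nhds ⟪z 0, y⟫) := by
  set T : H → H := fun p => orb Q p m with hTdef
  have hT : ∀ x y, ‖T x - T y‖ ≤ ‖x - y‖ := fun x y => orb_ne Q hQ x y m
  have hTR : ∀ x, ‖T x‖ ≤ R := by
    intro x
    obtain ⟨mm, rfl⟩ : ∃ mm, m = mm + 1 := ⟨m - 1, by omega⟩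
    exact hR _
  have hperk : ∀ k n, Q (n + k * m) = Q n := by
    intro k n
    induction k with
    | zero => simp
    | succ k ih => rw [← ih, ← hper (n + k * m)]; congr 1; ring
  have zper : ∀ p, T p = p → ∀ n, orb Q p (n + m) = orb Q p n := by
    intro p hp n
    induction n with
    | zero => rw [zero_add]; exact hp
    | succ n ih =>
      have : n + 1 + m = (n + m) + 1 := by ring
      rw [this]
      change Q (n + m + 1) _ = Q (n + 1) _
      rw [ih, ← this, hper]
  obtain ⟨p, hp⟩ := exists_fixed T hT R hTR
  have hreg := diff_tendsto Q hQ w (orb Q p) hw (fun _ => rfl) m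
  have hmul : Tendsto (fun k : ℕ => k * m) atTop atTop :=
    tendsto_id.atTop_mul_const' hm
  have huT : ∀ k, w ((k + 1) * m) = T (w (k * m)) := by
    intro k
    have := orb_unique Q (fun n => w (k * m + n)) (fun n => by
      change w (k * m + n + 1) = _
      rw [hw, ← hperk k (n + 1)]
      congr 1
      ring) m
    simp only [add_zero] at this
    rw [hTdef]
    simp only
    rw [← this]
    congr 1
    ring
  have hub : ∀ k, ‖w (k * m)‖ ≤ R := by
    intro k
    cases k with
    | zero => simpa using hw0
    | succ k => rw [huT]; exact hTR _
  have hu : Tendsto (fun k => w (k * m) - w ((k + 1) * m)) atTop (nhds 0) := by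
    have := (hreg.comp hmul).neg
    rw [neg_zero] at this
    refine this.congr fun k => ?_
    simp only [Function.comp]
    rw [zper p hp, add_mul, one_mul]
    abel
  obtain ⟨c, hc, hcl⟩ := weak_conv T hT (fun k => w (k * m)) R hub huT hu
  exact ⟨orb Q c, fun _ => rfl, zper c hc, diff_tendsto Q hQ w _ hw (fun _ => rfl), hcl⟩

end CyclicHelpers

/-- Gubin–Polyak–Raik: cyclic projections onto `m` nonempty closed convex sets, the first of
which is bounded, produce `m` weakly convergent subsequences whose weak limits form a cycle,
and the differences of consecutive iterates converge in norm to the corresponding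
differences of the cycle points.  (Indices here are `0`-based: `C i` plays the role of
`C_{i+1}`, and `x (k*m + i + 1) ∈ C i`.) -/
theorem stmt3 {H : Type*} [NormedAddCommGroup H] [InnerProductSpace ℝ H] [CompleteSpace H]
    {m : ℕ} [NeZero m]
    (C : Fin m → Set H) (hne : ∀ i, (C i).Nonempty) (hcl : ∀ i, IsClosed (C i))
    (hcv : ∀ i, Convex ℝ (C i)) (hbdd : Bornology.IsBounded (C 0))
    (P : Fin m → H → H) (hP : ∀ i, IsProjOn (P i) (C i))
    (x : ℕ → H)
    (hx : ∀ k : ℕ, x (k + 1) =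
      P ⟨k % m, Nat.mod_lt k (Nat.pos_of_ne_zero (NeZero.ne m))⟩ (x k)) :
    ∃ xb : Fin m → H,
      (∀ i, xb i ∈ C i) ∧
      (∀ i : Fin m, P (i + 1) (xb i) = xb (i + 1)) ∧
      (∀ i : Fin m,
        Tendsto (fun k : ℕ => x (k * m + (i : ℕ) + 2) - x (k * m + (i : ℕ) + 1)) atTop
          (nhds (xb (i + 1) - xb i))) ∧
      (∀ i : Fin m, ∀ y : H,
        Tendsto (fun k : ℕ => ⟪x (k * m + (i : ℕ) + 1), y⟫) atTop (nhds ⟪xb i, y⟫)) := by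
  have hm : 0 < m := Nat.pos_of_ne_zero (NeZero.ne m)
  let Q : ℕ → H → H := fun n => P ⟨n % m, Nat.mod_lt n hm⟩
  have hper : ∀ n, Q (n + m) = Q n := by
    intro n
    simp only [Q, Nat.add_mod_right]
  obtain ⟨R, hR⟩ := hbdd.exists_norm_le
  have hQ0 : Q 0 = P 0 := by
    simp only [Q]
    congr 1
  have hQm : Q m = P 0 := by
    rw [← hQ0, ← hper 0, zero_add]
  obtain ⟨z, hz, hzper, hd, hwk⟩ := cyclic_main m hm Q (fun n => proj_firm (hcv _) (hP _)) hper R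
    (fun p => hR _ (by rw [hQm]; exact (hP 0 p).1)) (fun n => x (n + 1)) (fun n => hx (n + 1))
    (hR _ (by
      have h0 := hx 0
      change x (0 + 1) = Q 0 (x 0) at h0
      rw [h0, hQ0]; exact (hP 0 _).1))
  have hmul : Tendsto (fun k : ℕ => k * m) atTop atTop :=
    tendsto_id.atTop_mul_const' hm
  have hzk : ∀ k n, z (k * m + n) = z n := by
    intro k n
    induction k with
    | zero => simp
    | succ k ih => rw [← ih, ← hzper (k * m + n)]; congr 1; ring
  have hsucc : ∀ i : Fin m, ((i + 1 : Fin m) : ℕ) = ((i : ℕ) + 1) % m := by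
    intro i
    rw [Fin.val_add, Fin.coe_ofNat_eq_mod, Nat.add_mod_mod]
  have hzmod : ∀ n, z (n % m) = z n := by
    intro n
    conv_rhs => rw [← Nat.div_add_mod' n m]
    rw [hzk]
  have hQi : ∀ i : Fin m, Q (i : ℕ) = P i := by
    intro i
    simp only [Q]
    congr 1
    ext
    simp [Nat.mod_eq_of_lt i.2]
  refine ⟨fun i => z i, ?_, ?_, ?_, ?_⟩
  · intro i
    have h1 : z ((i : ℕ) + m) = z i := hzper i
    have h2 : (i : ℕ) + m = ((i : ℕ) + m - 1) + 1 := by omega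
    simp only
    rw [← h1, h2, hz, ← h2, hper, hQi]
    exact (hP i _).1
  · intro i
    simp only
    rw [hsucc, hzmod, hz]
    have : P (i + 1) = Q ((i : ℕ) + 1) := by
      simp only [Q]
      congr 1
      ext
      rw [hsucc]
    rw [this]
  · intro i
    simp only
    rw [hsucc, hzmod]
    have h := ((hd 1).comp (tendsto_atTop_mono (fun k => Nat.le_add_right (k * m) (i : ℕ)) hmul)).add_const
      (z ((i : ℕ) + 1) - z i)
    rw [zero_add] at h
    refine h.congr fun k => ?_
    simp only [Function.comp, id]
    have e1 : z (k * m + (i : ℕ) + 1) = z ((i : ℕ) + 1) := by rw [add_assoc, hzk]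
    rw [e1, hzk]
    abel
  · intro i y
    have h := (((hd i).comp hmul).inner (tendsto_const_nhds (x := y))).add
      ((hwk y).add_const (⟪z i, y⟫ - ⟪z 0, y⟫))
    have e : inner ℝ (0 : H) y + (⟪z 0, y⟫ + (⟪z i, y⟫ - ⟪z 0, y⟫)) = ⟪z i, y⟫ := by
      rw [inner_zero_left]; ring
    rw [e] at h
    refine h.congr fun k => ?_
    simp only [Function.comp]
    have h0 : z (k * m) = z 0 := by simpa using hzk k 0
    rw [hzk, h0]
    simp only [inner_sub_left]
    ring
end

section
/- Let A ∈ ℝ^{(LM)×N} and b ∈ ℝ^{LM} be partitioned into M blocks A_i ∈ ℝ^{L×N} and b_i ∈ ℝ^L (i = 1, …, M), and fix x⁰ ∈ ℝ^N. For λ > 0 define the block-Kaczmarz iteration x^{k+1} = x^k + λ·A_iᵀ(b_i − A_i x^k) with i = (k mod M) + 1. Then there exists λ₀ > 0 such that for every λ ∈ (0, λ₀] the limit x*(λ) := lim_{k→∞} x^{kM} exists, and lim_{λ→0⁺} x*(λ) equals the orthogonal projection of x⁰ onto the set of least-squares solutions L := {x ∈ ℝ^N : ‖Ax − b‖ ≤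 ‖Ay − b‖ for all y ∈ ℝ^N} (equivalently, lim_{λ→0⁺} x*(λ) = A†b + (I − A†A)x⁰ with A† the Moore–Penrose inverse of A). -/
open Filter

/-- The total squared residual `‖Ax − b‖²` of the blocked linear system `Ax = b`,
where `A` and `b` are partitioned into `M` blocks `A i ∈ ℝ^{L×N}`, `b i ∈ ℝ^L`. -/
noncomputable def resid {L M N : ℕ} (A : Fin M → Matrix (Fin L) (Fin N) ℝ)
    (b : Fin M → Fin L → ℝ) (x : EuclideanSpace ℝ (Fin N)) : ℝ :=
  ∑ i, ∑ j, ((A i).mulVec x j - b i j) ^ 2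

/-- The set of least-squares solutions of the blocked system `Ax = b`. -/
noncomputable def lsSet {L M N : ℕ} (A : Fin M → Matrix (Fin L) (Fin N) ℝ)
    (b : Fin M → Fin L → ℝ) : Set (EuclideanSpace ℝ (Fin N)) :=
  {x | ∀ y : EuclideanSpace ℝ (Fin N), resid A b x ≤ resid A b y}

section KacCore
variable {E F : Type*} [NormedAddCommGroup E] [InnerProductSpace ℝ E]
  [NormedAddCommGroup F] [InnerProductSpace ℝ F]

lemma kac_step_bound (B : ℕ → E →L[ℝ] E) (n : ℕ) :
    ∃ C : ℝ, 0 ≤ C ∧ ∀ l : ℝ, 0 ≤ l → l ≤ 1 → ∀ (c : ℕ → E) (D : ℝ), 0 ≤ D →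
      (∀ j, ‖c j‖ ≤ D) → ∀ u : ℕ → E, (∀ j, u (j+1) = u j + l • (c j - B j (u j))) →
      ‖u n - u 0 - l • ∑ j ∈ Finset.range n, (c j - B j (u 0))‖ ≤ C * l^2 * (‖u 0‖ + D) := by
  induction n with
  | zero =>
    refine ⟨0, le_rfl, ?_⟩
    intros
    simp
  | succ n ih =>
    obtain ⟨C, hC, h⟩ := ih
    set S : ℝ := ∑ j ∈ Finset.range n, (1 + ‖B j‖) with hS
    have hS0 : 0 ≤ S := Finset.sum_nonneg fun j _ => by positivity
    refine ⟨C + ‖B n‖ * (C + S), by positivity, ?_⟩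
    intro l hl hl1 c D hD hc u hu
    have h1 := h l hl hl1 c D hD hc u hu
    set e := u n - u 0 - l • ∑ j ∈ Finset.range n, (c j - B j (u 0)) with he
    set R := ‖u 0‖ + D with hR
    have hR0 : 0 ≤ R := by positivity
    have h2 : ‖∑ j ∈ Finset.range n, (c j - B j (u 0))‖ ≤ S * R := by
      rw [hS, Finset.sum_mul]
      refine norm_sum_le_of_le _ fun j _ => ?_
      have h3 := norm_sub_le (c j) (B j (u 0))
      have h4 := (B j).le_opNorm (u 0)
      have h5 := hc j
      have h6 : 0 ≤ ‖B j‖ * D := by positivity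
      have := norm_nonneg (u 0)
      rw [hR]
      nlinarith
    have h3 : ‖u n - u 0‖ ≤ l * ((C + S) * R) := by
      have : u n - u 0 = e + l • ∑ j ∈ Finset.range n, (c j - B j (u 0)) := by
        rw [he]; abel
      rw [this]
      refine (norm_add_le _ _).trans ?_
      rw [norm_smul, Real.norm_of_nonneg hl]
      have h7 : l * ‖∑ j ∈ Finset.range n, (c j - B j (u 0))‖ ≤ l * (S * R) := by gcongr
      have h8 : C * l^2 * R ≤ C * l * R := by
        gcongr
        nlinarith
      nlinarith
    have h4 : u (n+1) - u 0 - l • ∑ j ∈ Finset.range (n+1), (c j - B j (u 0))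
        = e - l • B n (u n - u 0) := by
      rw [he, hu, Finset.sum_range_succ, map_sub]
      module
    rw [h4]
    refine (norm_sub_le _ _).trans ?_
    rw [norm_smul, Real.norm_of_nonneg hl]
    have h5 : ‖B n (u n - u 0)‖ ≤ ‖B n‖ * (l * ((C + S) * R)) :=
      ((B n).le_opNorm _).trans (by gcongr)
    have h6 : l * ‖B n (u n - u 0)‖ ≤ l * (‖B n‖ * (l * ((C + S) * R))) := by gcongr
    nlinarith

lemma kac_contr (H : E →L[ℝ] E) (W : Submodule ℝ E) (c : ℝ) (hc : 0 < c)
    (hco : ∀ w ∈ W, c * ‖w‖^2 ≤ inner ℝ (H w) w) :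
    ∃ l0 : ℝ, 0 < l0 ∧ l0 ≤ 1 ∧ ∀ l, 0 < l → l ≤ l0 → ∀ w ∈ W,
      ‖w - l • H w‖ ≤ (1 - c * l / 2) * ‖w‖ := by
  refine ⟨min 1 (min (1/c) (c/(‖H‖^2+1))), by positivity, min_le_left _ _, ?_⟩
  intro l hl hle w hw
  have h1 : l ≤ 1 / c := hle.trans ((min_le_right _ _).trans (min_le_left _ _))
  have h2 : l ≤ c/(‖H‖^2+1) := hle.trans ((min_le_right _ _).trans (min_le_right _ _))
  rw [le_div_iff₀ (by positivity)] at h1 h2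
  have h3 : 0 ≤ 1 - c * l / 2 := by nlinarith
  refine abs_le_of_sq_le_sq' ?_ (by positivity) |>.2
  rw [norm_sub_sq_real, real_inner_smul_right, norm_smul, Real.norm_of_nonneg hl.le,
    real_inner_comm]
  have h4 := hco w hw
  have h5 : ‖H w‖^2 ≤ ‖H‖^2 * ‖w‖^2 := by
    rw [← mul_pow]; exact pow_le_pow_left₀ (norm_nonneg _) (H.le_opNorm w) 2
  have h6 : l^2 * ‖H w‖^2 ≤ l * c * ‖w‖^2 := by
    calc l^2 * ‖H w‖^2 ≤ l^2 * (‖H‖^2 * ‖w‖^2) := by gcongr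
      _ = l * (l * ‖H‖^2) * ‖w‖^2 := by ring
      _ ≤ l * c * ‖w‖^2 := by gcongr; nlinarith
  have h7 : l * (c * ‖w‖^2) ≤ l * inner ℝ (H w) w := by gcongr
  have h8 : 0 ≤ (c * l / 2)^2 * ‖w‖^2 := by positivity
  nlinarith

lemma kac_core [CompleteSpace E] (B : ℕ → E →L[ℝ] E) (g : ℕ → E) (M : ℕ) (hM : 0 < M)
    (hB : Function.Periodic B M) (hg : Function.Periodic g M)
    (W : Submodule ℝ E) (c : ℝ) (hc : 0 < c)
    (hco : ∀ w ∈ W, c * ‖w‖^2 ≤ inner ℝ ((∑ j ∈ Finset.range M, B j) w) w)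
    (hBW : ∀ j x, B j x ∈ W) (hgW : ∀ j, g j ∈ W)
    (p x0 : E) (hp : x0 - p ∈ W) (hnormal : ∑ j ∈ Finset.range M, (g j - B j p) = 0)
    (x : ℝ → ℕ → E) (hx0 : ∀ l, x l 0 = x0)
    (hx : ∀ l k, x l (k+1) = x l k + l • (g k - B k (x l k))) :
    ∃ l0 > (0:ℝ), ∃ xs : ℝ → E,
      (∀ l ∈ Set.Ioc (0:ℝ) l0, Tendsto (fun k : ℕ => x l (k * M)) atTop (nhds (xs l))) ∧
      Tendsto xs (nhdsWithin 0 (Set.Ioi 0)) (nhds p) := by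
  obtain ⟨C, hC, hstep⟩ := kac_step_bound B M
  obtain ⟨l1, hl1, hl11, hcontr⟩ := kac_contr _ W c hc hco
  obtain ⟨l2, hl2, hl2C, hl2c⟩ : ∃ l2 : ℝ, 0 < l2 ∧ C * l2 ≤ c / 4 ∧ c * l2 ≤ 1 := by
    refine ⟨min (c / 4 / (C+1)) (1/c), by positivity, ?_, ?_⟩
    · have := min_le_left (c / 4 / (C+1)) (1/c)
      rw [le_div_iff₀ (by positivity)] at this
      have : 0 < min (c / 4 / (C+1)) (1/c) := by positivity
      nlinarith
    · have := min_le_right (c / 4 / (C+1)) (1/c)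
      rw [le_div_iff₀ (by positivity)] at this
      linarith
  -- main one-cycle estimate
  have key : ∀ l, 0 < l → l ≤ min l1 l2 → ∀ (d : ℕ → E) (D : ℝ), 0 ≤ D → (∀ j, ‖d j‖ ≤ D) →
      ∑ j ∈ Finset.range M, d j = 0 → ∀ u : ℕ → E,
      (∀ j, u (j+1) = u j + l • (d j - B j (u j))) → u 0 ∈ W →
      ‖u M‖ ≤ (1 - c * l / 4) * ‖u 0‖ + C * l^2 * D := by
    intro l hl hle d D hD hd hsum u hu huW
    have hle1 := hle.trans (min_le_left _ _)
    have hle2 := hle.trans (min_le_right _ _)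
    have h1 := hstep l hl.le (hle1.trans hl11) d D hD hd u hu
    have h2 := hcontr l hl hle1 (u 0) huW
    rw [Finset.sum_sub_distrib, hsum] at h1
    have h3 : u M = (u M - u 0 - l • (0 - ∑ j ∈ Finset.range M, B j (u 0)))
        + (u 0 - l • (∑ j ∈ Finset.range M, B j) (u 0)) := by
      rw [_root_.sum_apply]; module
    rw [h3]
    refine (norm_add_le _ _).trans ?_
    have h4 : C * l ≤ c / 4 := le_trans (by gcongr) hl2C
    have h5 : C * l * (l * ‖u 0‖) ≤ c / 4 * (l * ‖u 0‖) := by gcongr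
    nlinarith
  have hW : ∀ l k, x l k - p ∈ W := by
    intro l k
    induction k with
    | zero => rw [hx0]; exact hp
    | succ k ih =>
      rw [hx, add_sub_right_comm]
      exact W.add_mem ih (W.smul_mem _ (W.sub_mem (hgW _) (hBW _ _)))
  have hBk : ∀ k j, B (k * M + j) = B j := fun k j => by
    rw [add_comm]; exact_mod_cast hB.nat_mul k j
  have hgk : ∀ k j, g (k * M + j) = g j := fun k j => by
    rw [add_comm]; exact_mod_cast hg.nat_mul k j
  have hconv : ∀ l, 0 < l → l ≤ min l1 l2 →
      ∃ y, Tendsto (fun k : ℕ => x l (k * M)) atTop (nhds y) := by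
    intro l hl hle
    have hcl : c * l ≤ 1 := le_trans (by gcongr; exact hle.trans (min_le_right _ _)) hl2c
    have hd : ∀ k : ℕ, ‖x l ((k+1) * M) - x l (k * M)‖ ≤
        ‖x l (1 * M) - x l (0 * M)‖ * (1 - c * l / 4)^k := by
      intro k
      induction k with
      | zero => simp
      | succ k ih =>
        have := key l hl hle (fun _ => 0) 0 le_rfl (by simp) (by simp)
          (fun j => x l ((k+1) * M + j) - x l (k * M + j)) (fun j => by
            have e1 := hx l ((k+1)*M + j)
            have e2 := hx l (k*M + j)
            rw [hBk, hgk] at e1 e2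
            simp only [← add_assoc, e1, e2, map_sub]
            module) (by
            have := W.sub_mem (hW l ((k+1)*M + 0)) (hW l (k*M+0))
            simpa using this)
        simp only [add_zero, mul_zero] at this
        have e3 : (k+1+1)*M = (k+1)*M + M := by ring
        have e4 : (k+1)*M = k*M + M := by ring
        rw [e3]
        nth_rewrite 2 [e4]
        refine this.trans ?_
        rw [pow_succ]
        have : 0 ≤ 1 - c * l / 4 := by linarith
        calc _ ≤ (1 - c * l / 4) * (‖x l (1 * M) - x l (0 * M)‖ * (1 - c * l / 4)^k) := by
              gcongr
          _ = _ := by ring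
    refine cauchySeq_tendsto_of_complete (cauchySeq_of_le_geometric (1 - c * l / 4)
      (‖x l (1 * M) - x l (0 * M)‖) (by have := mul_pos hc hl; linarith) fun k => ?_)
    rw [dist_comm, dist_eq_norm]
    exact hd k
  let xs : ℝ → E := fun l => limUnder atTop (fun k : ℕ => x l (k * M))
  have hxs : ∀ l, 0 < l → l ≤ min l1 l2 →
      Tendsto (fun k : ℕ => x l (k * M)) atTop (nhds (xs l)) :=
    fun l hl hle => tendsto_nhds_limUnder (hconv l hl hle)
  refine ⟨min l1 l2, lt_min hl1 hl2, xs, fun l hl => hxs l hl.1 hl.2, ?_⟩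
  -- bound on the residual terms
  let d : ℕ → E := fun j => g j - B j p
  obtain ⟨D, hD, hdD⟩ : ∃ D : ℝ, 0 ≤ D ∧ ∀ j, ‖d j‖ ≤ D := by
    refine ⟨∑ j ∈ Finset.range M, ‖d j‖, by positivity, fun j => ?_⟩
    have : d j = d (j % M) := by
      have hdp : Function.Periodic d M := fun j => by simp only [d, hB j, hg j]
      exact (hdp.map_mod_nat j).symm
    rw [this]
    exact Finset.single_le_sum (f := fun j => ‖d j‖) (fun _ _ => norm_nonneg _)
      (Finset.mem_range.2 (Nat.mod_lt j hM))
  have hbound : ∀ l, 0 < l → l ≤ min l1 l2 → ‖xs l - p‖ ≤ 4 * C * D / c * l := by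
    intro l hl hle
    have hk : ∀ k : ℕ, ‖x l ((k+1)*M) - p‖ ≤ (1 - c * l / 4) * ‖x l (k*M) - p‖ + C * l^2 * D := by
      intro k
      have := key l hl hle d D hD hdD hnormal (fun j => x l (k * M + j) - p) (fun j => by
            have e2 := hx l (k*M + j)
            rw [hBk, hgk] at e2
            simp only [← add_assoc, e2, map_sub, d]
            module) (hW _ _)
      simp only [add_zero] at this
      have e4 : (k+1)*M = k*M + M := by ring
      rw [e4]; exact this
    have t1 := ((hxs l hl hle).sub_const p).norm
    have t2 := t1.comp (tendsto_add_atTop_nat 1)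
    have := le_of_tendsto_of_tendsto' t2 ((t1.const_mul (1 - c * l / 4)).add_const (C * l^2 * D)) hk
    have h1 : l * (c * ‖xs l - p‖) ≤ l * (4 * C * D * l) := by nlinarith
    have h2 := le_of_mul_le_mul_left h1 hl
    rw [div_mul_eq_mul_div, le_div_iff₀ hc]
    linarith
  rw [tendsto_iff_norm_sub_tendsto_zero]
  have hz : Tendsto (fun l : ℝ => 4 * C * D / c * l) (nhdsWithin 0 (Set.Ioi 0)) (nhds 0) := by
    have : Tendsto (fun l : ℝ => 4 * C * D / c * l) (nhds 0) (nhds (4 * C * D / c * 0)) :=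
      tendsto_id.const_mul _
    rw [mul_zero] at this
    exact this.mono_left nhdsWithin_le_nhds
  refine squeeze_zero' (Eventually.of_forall fun _ => norm_nonneg _) ?_ hz
  filter_upwards [Ioc_mem_nhdsGT (lt_min hl1 hl2)] with l hl
  exact hbound l hl.1 hl.2

end KacCore

lemma kac_adj {L N : ℕ} (A : Matrix (Fin L) (Fin N) ℝ) (x : EuclideanSpace ℝ (Fin N))
    (y : EuclideanSpace ℝ (Fin L)) :
    inner ℝ (Matrix.toEuclideanLin A.transpose y) x = inner ℝ y (Matrix.toEuclideanLin A x) := by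
  simp only [EuclideanSpace.inner_eq_star_dotProduct, Matrix.ofLp_toEuclideanLin_apply,
    star_trivial]
  rw [Matrix.mulVec_transpose, dotProduct_comm, ← Matrix.dotProduct_mulVec, dotProduct_comm]

/-- The stacked linear map. -/
noncomputable def kacS {L M N : ℕ} (A : Fin M → Matrix (Fin L) (Fin N) ℝ) :
    EuclideanSpace ℝ (Fin N) →ₗ[ℝ] PiLp 2 (fun _ : Fin M => EuclideanSpace ℝ (Fin L)) :=
  (WithLp.linearEquiv 2 ℝ (Fin M → EuclideanSpace ℝ (Fin L))).symm.toLinearMap ∘ₗ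
    LinearMap.pi (fun i => Matrix.toEuclideanLin (A i))

lemma kacS_apply {L M N : ℕ} (A : Fin M → Matrix (Fin L) (Fin N) ℝ)
    (x : EuclideanSpace ℝ (Fin N)) (i : Fin M) :
    kacS A x i = Matrix.toEuclideanLin (A i) x := rfl

/-- The stacked right-hand side. -/
noncomputable def kacb {L M : ℕ} (b : Fin M → Fin L → ℝ) :
    PiLp 2 (fun _ : Fin M => EuclideanSpace ℝ (Fin L)) :=
  WithLp.toLp 2 (fun i => WithLp.toLp 2 (b i))

lemma kac_resid {L M N : ℕ} (A : Fin M → Matrix (Fin L) (Fin N) ℝ)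
    (b : Fin M → Fin L → ℝ) (x : EuclideanSpace ℝ (Fin N)) :
    resid A b x = ‖kacS A x - kacb b‖^2 := by
  rw [PiLp.norm_sq_eq_of_L2]
  unfold resid
  refine Finset.sum_congr rfl fun i _ => ?_
  rw [EuclideanSpace.norm_sq_eq]
  refine Finset.sum_congr rfl fun j _ => ?_
  rw [Real.norm_eq_abs, sq_abs]
  rfl

/-- Existence of the projection together with its characterisations. -/
lemma kac_proj {L M N : ℕ} (A : Fin M → Matrix (Fin L) (Fin N) ℝ)
    (b : Fin M → Fin L → ℝ) (x0 : EuclideanSpace ℝ (Fin N)) :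
    ∃ p, p ∈ lsSet A b ∧ (∀ y ∈ lsSet A b, ‖x0 - p‖ ≤ ‖x0 - y‖) ∧
      x0 - p ∈ (LinearMap.ker (kacS A))ᗮ ∧
      ∀ y, inner ℝ (kacb b - kacS A p) (kacS A y) = (0:ℝ) := by
  set S := kacS A with hS
  set β := kacb b with hβ
  obtain ⟨x1, hx1⟩ : ∃ x1, S x1 = (LinearMap.range S).starProjection β := by
    have := (LinearMap.range S).starProjection_apply_mem β
    exact this
  set p := x1 + (LinearMap.ker S).starProjection (x0 - x1) with hp
  have hSp : S p = (LinearMap.range S).starProjection β := by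
    have : S ((LinearMap.ker S).starProjection (x0 - x1)) = 0 :=
      (LinearMap.ker S).starProjection_apply_mem (x0 - x1)
    rw [hp, map_add, this, hx1, add_zero]
  have horth : ∀ y, inner ℝ (β - S p) (S y) = (0:ℝ) := by
    intro y
    rw [hSp]
    exact Submodule.starProjection_inner_eq_zero β (S y) ⟨y, rfl⟩
  have hker : x0 - p ∈ (LinearMap.ker S)ᗮ := by
    have : x0 - p = (x0 - x1) - (LinearMap.ker S).starProjection (x0 - x1) := by
      rw [hp]; abel
    rw [this]
    exact Submodule.sub_starProjection_mem_orthogonal _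
  have hpyth : ∀ y, resid A b y = resid A b p + ‖S y - S p‖^2 := by
    intro y
    rw [kac_resid, kac_resid, ← hS, ← hβ]
    have h1 : S y - β = (S y - S p) - (β - S p) := by abel
    have h2 : inner ℝ (S y - S p) (β - S p) = (0:ℝ) := by
      rw [real_inner_comm, ← map_sub]; exact horth _
    rw [h1, norm_sub_sq_real, h2, norm_sub_rev (S p) β]
    ring
  have hpl : p ∈ lsSet A b := by
    intro y
    rw [hpyth y]
    have := sq_nonneg ‖S y - S p‖
    linarith
  refine ⟨p, hpl, ?_, hker, horth⟩
  intro y hy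
  have h1 := hy p
  rw [hpyth y] at h1
  have h2 : ‖S y - S p‖ = 0 := by
    have := sq_nonneg ‖S y - S p‖
    exact pow_eq_zero_iff two_ne_zero |>.1 (by linarith)
  have h3 : p - y ∈ LinearMap.ker S := by
    rw [LinearMap.mem_ker, map_sub, ← norm_eq_zero, norm_sub_rev]; exact h2
  have h4 : inner ℝ (x0 - p) (p - y) = (0:ℝ) := by
    rw [real_inner_comm]
    exact (Submodule.mem_orthogonal _ _).1 hker _ h3
  refine abs_le_of_sq_le_sq' ?_ (norm_nonneg _) |>.2
  have h5 : x0 - y = (x0 - p) + (p - y) := by abel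
  rw [h5, norm_add_sq_real, h4]
  have := sq_nonneg ‖p - y‖
  linarith

lemma kac_coer {L M N : ℕ} (A : Fin M → Matrix (Fin L) (Fin N) ℝ) :
    ∃ c : ℝ, 0 < c ∧ ∀ w ∈ (LinearMap.ker (kacS A))ᗮ, c * ‖w‖^2 ≤ ‖kacS A w‖^2 := by
  set S := kacS A with hS
  set W := (LinearMap.ker S)ᗮ with hW
  have hinj : LinearMap.ker (S.domRestrict W) = ⊥ := by
    rw [LinearMap.ker_eq_bot']
    intro w hw
    have h1 : (w : EuclideanSpace ℝ (Fin N)) ∈ LinearMap.ker S := hw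
    have h2 := (Submodule.mem_orthogonal _ _).1 w.2 _ h1
    exact Subtype.ext (inner_self_eq_zero.1 h2)
  obtain ⟨K, hK, hanti⟩ := (S.domRestrict W).exists_antilipschitzWith hinj
  have hK' : (0:ℝ) < K := hK
  refine ⟨1 / (K:ℝ)^2, by positivity, fun w hw => ?_⟩
  have h1 : ‖w‖ ≤ K * ‖S w‖ := by
    have := hanti.le_mul_dist ⟨w, hw⟩ 0
    simpa [dist_eq_norm] using this
  have h2 := pow_le_pow_left₀ (norm_nonneg _) h1 2
  rw [div_mul_eq_mul_div, one_mul, div_le_iff₀ (by positivity)]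
  linarith [mul_pow (K:ℝ) ‖S w‖ 2]


/-- Censor–Eggermont–Gordon: for all sufficiently small relaxation parameters `λ` the cyclic
subsequence limits `x*(λ)` of the block-Kaczmarz method exist, and as `λ → 0⁺` they tend to
the orthogonal projection of the starting point onto the set of least-squares solutions. -/
theorem stmt4 {L M N : ℕ} (hM : 0 < M)
    (A : Fin M → Matrix (Fin L) (Fin N) ℝ) (b : Fin M → Fin L → ℝ)
    (x0 : EuclideanSpace ℝ (Fin N))
    (xseq : ℝ → ℕ → EuclideanSpace ℝ (Fin N))
    (hinit : ∀ lam : ℝ, xseq lam 0 = x0)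
    (hiter : ∀ (lam : ℝ) (k : ℕ),
      xseq lam (k + 1) = xseq lam k +
        lam • (EuclideanSpace.equiv (Fin N) ℝ).symm
          ((A ⟨k % M, Nat.mod_lt k hM⟩).transpose.mulVec
            (b ⟨k % M, Nat.mod_lt k hM⟩ - (A ⟨k % M, Nat.mod_lt k hM⟩).mulVec (xseq lam k)))) :
    ∃ lam₀ > (0 : ℝ), ∃ xstar : ℝ → EuclideanSpace ℝ (Fin N),
      (∀ lam ∈ Set.Ioc (0 : ℝ) lam₀,
        Tendsto (fun k : ℕ => xseq lam (k * M)) atTop (nhds (xstar lam))) ∧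
      ∃ p : EuclideanSpace ℝ (Fin N),
        p ∈ lsSet A b ∧ (∀ y ∈ lsSet A b, ‖x0 - p‖ ≤ ‖x0 - y‖) ∧
        Tendsto xstar (nhdsWithin 0 (Set.Ioi 0)) (nhds p) := by
  obtain ⟨p, hp1, hp2, hp3, hp4⟩ := kac_proj A b x0
  obtain ⟨c, hc, hco⟩ := kac_coer A
  let ix : ℕ → Fin M := fun k => ⟨k % M, Nat.mod_lt k hM⟩
  have hix : Function.Periodic ix M := fun k => by simp [ix]
  have hixF : ∀ i : Fin M, ix i = i := fun i => Fin.ext (Nat.mod_eq_of_lt i.2)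
  let B' : Fin M → EuclideanSpace ℝ (Fin N) →L[ℝ] EuclideanSpace ℝ (Fin N) := fun i =>
    LinearMap.toContinuousLinearMap
      (Matrix.toEuclideanLin (A i).transpose ∘ₗ Matrix.toEuclideanLin (A i))
  have hB'a : ∀ i x, B' i x = Matrix.toEuclideanLin (A i).transpose
    (Matrix.toEuclideanLin (A i) x) := fun _ _ => rfl
  let g' : Fin M → EuclideanSpace ℝ (Fin N) := fun i =>
    Matrix.toEuclideanLin (A i).transpose (kacb b i)
  have hT' : ∀ i y, Matrix.toEuclideanLin (A i).transpose y ∈ (LinearMap.ker (kacS A))ᗮ := by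
    intro i y
    rw [Submodule.mem_orthogonal]
    intro z hz
    rw [real_inner_comm, kac_adj, ← kacS_apply, LinearMap.mem_ker.1 hz]
    simp
  obtain ⟨l0, hl0, xs, h1, h2⟩ := kac_core (fun k => B' (ix k)) (fun k => g' (ix k)) M hM
    (fun k => by simp only [hix k]) (fun k => by simp only [hix k])
    (LinearMap.ker (kacS A))ᗮ c hc
    (by
      intro w hw
      refine (hco w hw).trans_eq ?_
      rw [Finset.sum_range, _root_.sum_apply, sum_inner, PiLp.norm_sq_eq_of_L2]
      refine Finset.sum_congr rfl fun i _ => ?_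
      simp only [hixF]
      rw [hB'a, kac_adj, real_inner_self_eq_norm_sq, kacS_apply])
    (fun j x => hT' _ _) (fun j => hT' _ _) p x0 hp3
    (by
      rw [Finset.sum_range]
      simp only [hixF]
      refine ext_inner_right ℝ fun y => ?_
      rw [inner_zero_left, sum_inner, ← hp4 y, PiLp.inner_apply]
      refine Finset.sum_congr rfl fun i _ => ?_
      rw [hB'a, ← map_sub, kac_adj]
      rfl)
    xseq hinit
    (by
      intro l k
      rw [hiter l k, hB'a, ← map_sub]
      rfl)
  exact ⟨l0, hl0, xs, h1, p, hp1, hp2, h2⟩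
end
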